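/- Fix a k-cycle c ∈ S_k. The number of permutations σ ∈ S_k such that c(σ) + c(σ⁻¹ ∘ c) = k + 1 equals the Catalan number C_k = (1/(k+1))·C(2k, k), where c(·) denotes the number of cycles of a permutation. -/

import Mathlib

open Equiv

/-- The number of cycles (orbits, including fixed points) of a permutation of `Fin k`. -/
def cycleCount {k : ℕ} (σ : Equiv.Perm (Fin k)) : ℕ :=
  σ.cycleType.card + (k - σ.support.card)

theorem List.formPerm_cons_append_cons {α : Type*} [DecidableEq α] (x y : α) (l₁ l₂ : List α)
    (h : (x :: (l₁ ++ y :: l₂)).Nodup) :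
    (x :: (l₁ ++ y :: l₂)).formPerm = Equiv.swap x y * ((x :: l₁).formPerm * (y :: l₂).formPerm) := by
  induction l₁ generalizing x with
  | nil => simp
  | cons w l ih =>
    have hw := ih w h.of_cons
    simp only [List.cons_append, List.nodup_cons, List.mem_cons, List.mem_append, not_or] at h
    rw [List.cons_append, List.formPerm_cons_cons, hw, List.formPerm_cons_cons]
    simp only [← mul_assoc]
    congr 2
    rw [mul_swap_eq_swap_mul, swap_apply_right, swap_apply_of_ne_of_ne (Ne.symm h.1.2.2.1)
      (Ne.symm h.2.1.2.1)]

namespace Equiv.Perm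

variable {α : Type*} [DecidableEq α]

theorem formPerm_mul_apply_mem {l : List α} {d : Perm α} (hd : ∀ y ∈ l, d y = y) {y : α}
    (hy : y ∈ l) : (l.formPerm * d) y ∈ l := by
  rw [mul_apply, hd y hy]
  exact List.formPerm_apply_mem_of_mem hy

/-- The permutation obtained from `σ` by deleting `x` from its cycle and making it a fixed point. -/
def isolate (x : α) (σ : Perm α) : Perm α := swap x (σ x) * σ

theorem isolate_apply_self (x : α) (σ : Perm α) : isolate x σ x = x := by simp [isolate]

theorem isolate_mul_of_apply_eq {x : α} {σ : Perm α} (hσ : σ x = x) (τ : Perm α) :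
    isolate x (σ * τ) = σ * isolate x τ := by
  rw [isolate, isolate, ← mul_assoc σ, mul_swap_eq_swap_mul, hσ, mul_assoc, mul_apply]

theorem isolate_inv_mul_isolate (x : α) (σ c : Perm α) :
    (isolate x σ)⁻¹ * isolate x (swap x (σ x) * c) = isolate x (σ⁻¹ * c) := by
  rw [inv_mul_eq_iff_eq_mul, ← isolate_mul_of_apply_eq (isolate_apply_self x σ), isolate.eq_def x σ,
    mul_assoc, mul_inv_cancel_left]

theorem isolate_formPerm_cons_mul {x : α} {l : List α} {d : Perm α} (hl : (x :: l).Nodup)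
    (hd : d x = x) : isolate x ((x :: l).formPerm * d) = l.formPerm * d := by
  rcases l with _ | ⟨w, l⟩
  · simp [isolate, hd, ← Equiv.Perm.one_def]
  · rw [isolate, mul_apply, hd, List.formPerm_apply_head x w l hl, List.formPerm_cons_cons,
      mul_assoc, swap_mul_self_mul]

theorem isolate_swap_mul_formPerm_mul {x y : α} {l₁ l₂ : List α} {d : Perm α}
    (hl : (x :: (l₁ ++ y :: l₂)).Nodup) (hd : d x = x) :
    isolate x (swap x y * ((x :: (l₁ ++ y :: l₂)).formPerm * d)) =
      l₁.formPerm * ((y :: l₂).formPerm * d) := by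
  have hn : (x :: l₁).Nodup := by
    rw [← List.cons_append, List.nodup_append] at hl
    exact hl.1
  have hx : x ∉ y :: l₂ := fun h => (List.nodup_cons.1 hl).1 (List.mem_append_right _ h)
  have hyd : ((y :: l₂).formPerm * d) x = x := by
    rw [mul_apply, hd, List.formPerm_apply_of_notMem hx]
  rw [List.formPerm_cons_append_cons x y l₁ l₂ hl, mul_assoc, swap_mul_self_mul, mul_assoc,
    isolate_formPerm_cons_mul hn hyd]

theorem prod_map_formPerm_apply_of_notMem {L : List (List α)} {x : α} (hx : x ∉ L.flatten) :
    (L.map List.formPerm).prod x = x := by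
  induction L with
  | nil => rfl
  | cons l L ih =>
    rw [List.flatten_cons, List.mem_append, not_or] at hx
    rw [List.map_cons, List.prod_cons, mul_apply, ih hx.2, List.formPerm_apply_of_notMem hx.1]

variable [Fintype α]

/-- The least number of transpositions in a factorization of `σ`: the sum of `n - 1` over the
lengths `n` of the cycles of `σ`. -/
def reflectionLength (σ : Perm α) : ℕ := (σ.cycleType.map (· - 1)).sum

theorem reflectionLength_one : (1 : Perm α).reflectionLength = 0 := by simp [reflectionLength]

theorem reflectionLength_add_card_cycleType (σ : Perm α) :
    σ.reflectionLength + σ.cycleType.card = σ.support.card := by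
  have h : σ.cycleType.map (fun n => n - 1 + 1) = σ.cycleType.map id :=
    Multiset.map_congr rfl fun n hn => Nat.sub_add_cancel (one_lt_of_mem_cycleType hn).le
  rw [← sum_cycleType, ← Multiset.map_id σ.cycleType, ← h, reflectionLength, Multiset.sum_map_add]
  simp

theorem reflectionLength_formPerm {l : List α} (hl : l.Nodup) :
    l.formPerm.reflectionLength = l.length - 1 := by
  rcases le_or_gt 2 l.length with h | h
  · rw [reflectionLength, (List.isCycle_formPerm hl h).cycleType,
      List.support_formPerm_of_nodup l hl]
    · simp [List.toFinset_card_of_nodup hl]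
    · rintro x rfl
      simp at h
  · rw [(List.formPerm_eq_one_iff l hl).2 (by omega), reflectionLength_one]
    omega

theorem reflectionLength_formPerm_mul {l : List α} {d : Perm α} (hl : l.Nodup)
    (hd : ∀ y ∈ l, d y = y) :
    (l.formPerm * d).reflectionLength = l.length - 1 + d.reflectionLength := by
  have h : Disjoint l.formPerm d := fun y => by
    by_cases hy : y ∈ l
    · exact Or.inr (hd y hy)
    · exact Or.inl (List.formPerm_apply_of_notMem hy)
  rw [← reflectionLength_formPerm hl, reflectionLength, h.cycleType_mul, Multiset.map_add,
    Multiset.sum_add, reflectionLength, reflectionLength]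

theorem exists_eq_formPerm_mul (σ : Perm α) (x : α) :
    ∃ (l : List α) (d : Perm α), (x :: l).Nodup ∧ (∀ y ∈ x :: l, d y = y) ∧
      σ = (x :: l).formPerm * d := by
  by_cases hx : σ x = x
  · exact ⟨[], σ, by simp, by simpa using hx, by simp⟩
  have hx' : x ∈ σ.support := mem_support.2 hx
  obtain ⟨l, hl⟩ : ∃ l, σ.toList x = x :: l := by
    have h0 := toList_getElem_zero σ x hx'
    rcases h : σ.toList x with _ | ⟨y, l⟩
    · exact absurd hx' (toList_eq_nil_iff.1 h)
    · simp only [h, List.getElem_cons_zero] at h0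
      exact ⟨l, by rw [h0]⟩
  refine ⟨l, (σ.cycleOf x)⁻¹ * σ, hl ▸ nodup_toList σ x, fun y hy => ?_, ?_⟩
  · rw [← hl, mem_toList_iff] at hy
    rw [mul_apply, inv_eq_iff_eq, hy.1.cycleOf_apply]
  · rw [← hl, formPerm_toList, mul_inv_cancel_left]

theorem reflectionLength_swap_mul_of_mem {x y : α} {l : List α} {d : Perm α}
    (hl : (x :: l).Nodup) (hd : ∀ z ∈ x :: l, d z = z) (hy : y ∈ l) :
    (swap x y * ((x :: l).formPerm * d)).reflectionLength + 1 =
      ((x :: l).formPerm * d).reflectionLength := by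
  obtain ⟨l₁, l₂, rfl⟩ := List.append_of_mem hy
  rw [reflectionLength_formPerm_mul hl hd, List.formPerm_cons_append_cons _ _ _ _ hl,
    mul_assoc, swap_mul_self_mul, mul_assoc]
  rw [← List.cons_append, List.nodup_append] at hl
  obtain ⟨h₁, h₂, h₃⟩ := hl
  rw [reflectionLength_formPerm_mul h₁, reflectionLength_formPerm_mul h₂]
  · simp
    omega
  · exact fun z hz => hd z (by simp at hz ⊢; tauto)
  · intro z hz
    rw [mul_apply, hd z (by simp at hz ⊢; tauto), List.formPerm_apply_of_notMem]
    exact fun hz' => h₃ z hz z hz' rfl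

theorem reflectionLength_swap_mul_of_notMem {x y : α} {l : List α} {d : Perm α}
    (hl : (x :: l).Nodup) (hd : ∀ z ∈ x :: l, d z = z) (hy : y ∉ x :: l) :
    (swap x y * ((x :: l).formPerm * d)).reflectionLength =
      ((x :: l).formPerm * d).reflectionLength + 1 := by
  obtain ⟨m, e, hm, he, rfl⟩ := exists_eq_formPerm_mul d y
  have hlm : ∀ z ∈ x :: l, z ∉ y :: m := fun z hz hzm => by
    have h := hd z hz
    rw [mul_apply, he z hzm, List.formPerm_apply_mem_eq_self_iff _ hm z hzm] at h
    obtain rfl : m = [] := List.length_eq_zero_iff.1 (by simpa using h)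
    rw [List.mem_singleton] at hzm
    exact hy (hzm ▸ hz)
  have hn : (x :: (l ++ y :: m)).Nodup := by
    rw [← List.cons_append, List.nodup_append]
    exact ⟨hl, hm, fun a ha b hb hab => hlm a ha (hab ▸ hb)⟩
  have he' : ∀ z ∈ x :: l, e z = z := fun z hz => by
    have h := hd z hz
    by_contra hez
    by_cases hm' : e z ∈ y :: m
    · exact hez (e.injective (he _ hm'))
    · rw [mul_apply, List.formPerm_apply_of_notMem hm'] at h
      exact hez h
  rw [reflectionLength_formPerm_mul hl hd, reflectionLength_formPerm_mul hm he,
    ← mul_assoc (List.formPerm _), ← mul_assoc, ← List.formPerm_cons_append_cons _ _ _ _ hn,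
    reflectionLength_formPerm_mul hn]
  · simp
    omega
  · intro z hz
    rw [← List.cons_append, List.mem_append] at hz
    exact hz.elim (he' z) (he z)

theorem reflectionLength_swap_mul_le (x y : α) (σ : Perm α) :
    (swap x y * σ).reflectionLength ≤ σ.reflectionLength + 1 := by
  obtain ⟨l, d, hl, hd, rfl⟩ := exists_eq_formPerm_mul σ x
  by_cases hy : y ∈ x :: l
  · rcases List.mem_cons.1 hy with rfl | hy
    · simp [swap_self, ← Equiv.Perm.one_def]
    · have := reflectionLength_swap_mul_of_mem hl hd hy
      omega
  · exact (reflectionLength_swap_mul_of_notMem hl hd hy).le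

theorem reflectionLength_isolate (x : α) (σ : Perm α) :
    (isolate x σ).reflectionLength + (if σ x = x then 0 else 1) = σ.reflectionLength := by
  split_ifs with h
  · simp [isolate, h, swap_self, ← Equiv.Perm.one_def]
  · obtain ⟨l, d, hl, hd, hσ⟩ := exists_eq_formPerm_mul σ x
    have hmem : σ x ∈ x :: l := hσ ▸ formPerm_mul_apply_mem hd List.mem_cons_self
    have := reflectionLength_swap_mul_of_mem hl hd ((List.mem_cons.1 hmem).resolve_left h)
    rwa [← hσ] at this

theorem reflectionLength_mul_le (σ τ : Perm α) :
    (σ * τ).reflectionLength ≤ σ.reflectionLength + τ.reflectionLength := by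
  induction h : σ.reflectionLength using Nat.strong_induction_on generalizing σ with
  | _ n ih =>
    by_cases hσ : σ = 1
    · simp [hσ]
    obtain ⟨x, hx⟩ : ∃ x, σ x ≠ x := by
      by_contra! hx
      exact hσ (Equiv.ext hx)
    have hlen := reflectionLength_isolate x σ
    rw [if_neg hx] at hlen
    have h₁ := ih _ (by omega) (isolate x σ) rfl
    have h₂ := reflectionLength_swap_mul_le x (σ x) (isolate x σ * τ)
    rw [isolate, mul_assoc, swap_mul_self_mul, ← mul_assoc, ← isolate] at h₂
    omega

/-- The pair `(σ, σ⁻¹ * c)` is a minimal factorization of `c`. -/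
def IsMinimalFactor (c σ : Perm α) : Prop :=
  σ.reflectionLength + (σ⁻¹ * c).reflectionLength = c.reflectionLength

instance (c : Perm α) : DecidablePred (IsMinimalFactor c) :=
  fun _ => inferInstanceAs (Decidable (_ = _))

theorem IsMinimalFactor.apply_mem {σ d : Perm α} {x : α} {l : List α} (hl : (x :: l).Nodup)
    (hd : ∀ z ∈ x :: l, d z = z) (h : IsMinimalFactor ((x :: l).formPerm * d) σ) :
    σ x ∈ x :: l := by
  by_contra hx
  have h₁ := reflectionLength_swap_mul_of_notMem hl hd hx
  have h₂ := reflectionLength_isolate x σ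
  rw [if_neg fun h' => hx (by rw [h']; exact List.mem_cons_self)] at h₂
  have h₃ := reflectionLength_mul_le (isolate x σ) (σ⁻¹ * ((x :: l).formPerm * d))
  rw [isolate, mul_assoc, mul_inv_cancel_left, ← isolate] at h₃
  unfold IsMinimalFactor at h
  omega

theorem IsMinimalFactor.apply_eq {c σ : Perm α} {x : α} (hc : c x = x)
    (h : IsMinimalFactor c σ) : σ x = x := by
  have := IsMinimalFactor.apply_mem (x := x) (l := []) (d := c) (σ := σ) (by simp)
    (by simpa using hc) (by simpa using h)
  simpa using this

theorem isMinimalFactor_isolate_iff {c σ : Perm α} {x : α}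
    (h : (swap x (σ x) * c).reflectionLength + (if σ x = x then 0 else 1) = c.reflectionLength) :
    IsMinimalFactor (isolate x (swap x (σ x) * c)) (isolate x σ) ↔ IsMinimalFactor c σ := by
  have h₁ := reflectionLength_isolate x σ
  have h₂ := reflectionLength_isolate x (σ⁻¹ * c)
  have h₃ := reflectionLength_isolate x (swap x (σ x) * c)
  have h₄ : (swap x (σ x) * c) x = x ↔ (σ⁻¹ * c) x = x := by
    rw [mul_apply, mul_apply, swap_apply_eq_iff, swap_apply_left, inv_eq_iff_eq, eq_comm]
  simp only [h₄] at h₃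
  rw [IsMinimalFactor, IsMinimalFactor, isolate_inv_mul_isolate]
  omega

/-- The number of minimal factorizations of `c` into two factors. -/
def numMinimalFactors (c : Perm α) : ℕ :=
  Fintype.card {σ : Perm α // IsMinimalFactor c σ}

theorem card_isMinimalFactor_apply_eq {x y : α} {l : List α} {d : Perm α} (hl : (x :: l).Nodup)
    (hd : ∀ z ∈ x :: l, d z = z) (hy : y ∈ x :: l) :
    ({σ | IsMinimalFactor ((x :: l).formPerm * d) σ ∧ σ x = y} : Finset (Perm α)).card =
      numMinimalFactors (isolate x (swap x y * ((x :: l).formPerm * d))) := by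
  have hlen : (swap x y * ((x :: l).formPerm * d)).reflectionLength + (if y = x then 0 else 1) =
      ((x :: l).formPerm * d).reflectionLength := by
    split_ifs with h
    · simp [h, swap_self, ← Equiv.Perm.one_def]
    · exact reflectionLength_swap_mul_of_mem hl hd ((List.mem_cons.1 hy).resolve_left h)
  rw [numMinimalFactors, Fintype.card_subtype]
  refine Finset.card_nbij' (isolate x) (swap x y * ·) ?_ ?_ ?_ ?_
  · intro σ hσ
    simp only [Finset.coe_filter, Finset.mem_univ, true_and, Set.mem_ofPred_eq] at hσ ⊢
    obtain ⟨hσ, rfl⟩ := hσ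
    exact (isMinimalFactor_isolate_iff hlen).2 hσ
  · intro ρ hρ
    simp only [Finset.coe_filter, Finset.mem_univ, true_and, Set.mem_ofPred_eq] at hρ ⊢
    have hx : ρ x = x := hρ.apply_eq (isolate_apply_self _ _)
    have hy' : (swap x y * ρ) x = y := by rw [mul_apply, hx, swap_apply_left]
    refine ⟨(isMinimalFactor_isolate_iff (x := x) (by rwa [hy'])).1 ?_, hy'⟩
    have hρ' : isolate x (swap x y * ρ) = ρ := by rw [isolate, hy', swap_mul_self_mul]
    rwa [hy', hρ']
  · intro σ hσ
    simp only [Finset.coe_filter, Finset.mem_univ, true_and, Set.mem_ofPred_eq] at hσ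
    simp only [isolate, hσ.2, swap_mul_self_mul]
  · intro ρ hρ
    simp only [Finset.coe_filter, Finset.mem_univ, true_and, Set.mem_ofPred_eq] at hρ
    have hx : ρ x = x := hρ.apply_eq (isolate_apply_self _ _)
    simp only [isolate, mul_apply, hx, swap_apply_left, swap_mul_self_mul]

theorem numMinimalFactors_formPerm_cons_mul {x : α} {l : List α} {d : Perm α}
    (hl : (x :: l).Nodup) (hd : ∀ z ∈ x :: l, d z = z) :
    numMinimalFactors ((x :: l).formPerm * d) = ∑ i : Fin (l.length + 1),
      numMinimalFactors ((l.take i).formPerm * ((l.drop i).formPerm * d)) := by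
  have hmaps : Set.MapsTo (fun σ : Perm α => σ x)
      (({σ | IsMinimalFactor ((x :: l).formPerm * d) σ} : Finset (Perm α)) : Set (Perm α))
      ((x :: l).toFinset : Set α) := fun σ hσ => by
    simp only [Finset.coe_filter, Finset.mem_univ, true_and, Set.mem_ofPred_eq] at hσ
    simpa using hσ.apply_mem hl hd
  rw [numMinimalFactors, Fintype.card_subtype, Finset.card_eq_sum_card_fiberwise hmaps]
  simp only [Finset.filter_filter]
  have hfiber := Finset.sum_congr (rfl : (x :: l).toFinset = _) fun y hy =>
    card_isMinimalFactor_apply_eq hl hd (List.mem_toFinset.1 hy)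
  rw [hfiber, List.sum_toFinset _ hl, List.map_cons, List.sum_cons, ← Fin.sum_univ_fun_getElem,
    Fin.sum_univ_castSucc, add_comm]
  refine congrArg₂ (· + ·) ?_ ?_
  · refine Finset.sum_congr rfl fun i _ => congrArg numMinimalFactors ?_
    have hi : l.take i ++ l[(i : ℕ)] :: l.drop (i + 1) = l := by simp
    have hi' := isolate_swap_mul_formPerm_mul (x := x) (y := l[(i : ℕ)]) (l₁ := l.take i)
      (l₂ := l.drop (i + 1)) (d := d) (by rwa [hi]) (hd x List.mem_cons_self)
    rwa [hi, ← List.drop_eq_getElem_cons] at hi'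
  · rw [swap_self, ← Equiv.Perm.one_def, one_mul,
      isolate_formPerm_cons_mul hl (hd x List.mem_cons_self)]
    simp

theorem numMinimalFactors_prod_map_formPerm (L : List (List α)) (hL : L.flatten.Nodup) :
    numMinimalFactors (L.map List.formPerm).prod = (L.map fun l => catalan l.length).prod := by
  induction h : 2 * L.flatten.length + L.length using Nat.strong_induction_on generalizing L with
  | _ n ih =>
    rcases L with _ | ⟨_ | ⟨x, l⟩, L⟩
    · have h1 : ∀ σ : Perm α, IsMinimalFactor 1 σ ↔ σ = 1 := fun σ =>
        ⟨fun hσ => Equiv.ext fun x => hσ.apply_eq rfl, fun hσ => by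
          simp [hσ, IsMinimalFactor, reflectionLength_one]⟩
      simp [numMinimalFactors, h1]
    · simpa using ih _ (by simp at h ⊢; omega) L (by simpa using hL) rfl
    · have hd : ∀ z ∈ x :: l, (L.map List.formPerm).prod z = z := fun z hz =>
        prod_map_formPerm_apply_of_notMem fun hz' => by
          rw [List.flatten_cons, List.nodup_append] at hL
          exact hL.2.2 z hz z hz' rfl
      rw [List.flatten_cons] at hL
      rw [List.map_cons, List.prod_cons,
        numMinimalFactors_formPerm_cons_mul (List.nodup_append.1 hL).1 hd, List.map_cons,
        List.prod_cons, List.length_cons, catalan_succ, Finset.sum_mul]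
      refine Finset.sum_congr rfl fun i _ => ?_
      have hflat : (l.take i :: l.drop i :: L).flatten = l ++ L.flatten := by
        simp [← List.append_assoc]
      have := ih _ ?_ (l.take i :: l.drop i :: L) (hflat ▸ hL.of_cons) rfl
      · simpa [mul_assoc, Nat.min_eq_left (Nat.le_of_lt_succ i.2)] using this
      · rw [hflat]
        simp at h ⊢
        omega

end Equiv.Perm

theorem cycleCount_add_reflectionLength {k : ℕ} (σ : Equiv.Perm (Fin k)) :
    cycleCount σ + σ.reflectionLength = k := by
  have h₁ := σ.reflectionLength_add_card_cycleType
  have h₂ := σ.support.card_le_univ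
  rw [Fintype.card_fin] at h₂
  unfold cycleCount
  omega

theorem exists_eq_formPerm_of_cycleCount_eq_one {k : ℕ} {c : Equiv.Perm (Fin k)}
    (hc : cycleCount c = 1) : ∃ l : List (Fin k), l.Nodup ∧ l.length = k ∧ c = l.formPerm := by
  have hk : 0 < k := by
    have := cycleCount_add_reflectionLength c
    omega
  obtain ⟨l, d, hl, hd, rfl⟩ := c.exists_eq_formPerm_mul ⟨0, hk⟩
  have h₁ := cycleCount_add_reflectionLength ((⟨0, hk⟩ :: l).formPerm * d)
  rw [hc, Equiv.Perm.reflectionLength_formPerm_mul hl hd, List.length_cons] at h₁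
  have h₂ := d.reflectionLength_add_card_cycleType
  have h₃ : d.support.card + (⟨0, hk⟩ :: l).toFinset.card ≤ k := by
    rw [← Finset.card_union_of_disjoint]
    · exact (Finset.card_le_univ _).trans (Fintype.card_fin k).le
    · refine Finset.disjoint_left.2 fun y hy hyl => ?_
      exact Equiv.Perm.mem_support.1 hy (hd y (List.mem_toFinset.1 hyl))
  rw [List.toFinset_card_of_nodup hl, List.length_cons] at h₃
  obtain rfl : d = 1 := Equiv.Perm.card_cycleType_eq_zero.1 (by omega)
  rw [Equiv.Perm.reflectionLength_one] at h₁
  exact ⟨_, hl, by rw [List.length_cons]; omega, mul_one _⟩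

/-- The number of genus-zero factorizations of a fixed `k`-cycle, i.e. permutations `σ` with
`c(σ) + c(σ⁻¹c) = k + 1`, equals the Catalan number `C(2k, k) / (k + 1)`. -/
theorem card_genus_zero_factorizations (k : ℕ) (c : Equiv.Perm (Fin k))
    (hc : cycleCount c = 1) :
    Fintype.card {σ : Equiv.Perm (Fin k) // cycleCount σ + cycleCount (σ⁻¹ * c) = k + 1} =
      (2 * k).choose k / (k + 1) := by
  obtain ⟨l, hl, hlen, rfl⟩ := exists_eq_formPerm_of_cycleCount_eq_one hc
  have h := Equiv.Perm.numMinimalFactors_prod_map_formPerm [l] (by simpa using hl)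
  simp only [List.map_cons, List.map_nil, List.prod_cons, List.prod_nil, mul_one, hlen] at h
  rw [catalan_eq_centralBinom_div, Nat.centralBinom] at h
  rw [← h, Equiv.Perm.numMinimalFactors]
  refine Fintype.card_congr (Equiv.subtypeEquivRight fun σ => ?_)
  have h₁ := cycleCount_add_reflectionLength σ
  have h₂ := cycleCount_add_reflectionLength (σ⁻¹ * l.formPerm)
  have h₃ := cycleCount_add_reflectionLength l.formPerm
  unfold Equiv.Perm.IsMinimalFactor
  omega
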